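/- arXiv:2106.05114 — 3 statements merged into one kernel-verified Lean document; each statement's English description precedes it below -/
import Mathlib

section
/- Let d ∈ ℕ*, r > 0, h > 0, c > 0 and α ∈ [0,1). Let T = B̄(0,r) ⊂ ℝ^d be the closed ball of radius r, let k_h(θ,y) = (2πh²)^{−d/2} exp(−‖y−θ‖²/(2h²)) for θ ∈ T, y ∈ ℝ^d, and let p(y) = c · [0.5 (2π)^{−d/2} exp(−‖y−θ_1*‖²/2) + 0.5 (2π)^{−d/2} exp(−‖y−θ_2*‖²/2)] with θ_1*, θ_2* ∈ T. Then ∫_{ℝ^d} sup_{θ∈T} k_h(θ,y) · sup_{θ'∈T} (k_h(θ',y)/p(y))^{α−1} dy < ∞. -/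
open MeasureTheory Real

noncomputable section

/-- Gaussian kernel density with bandwidth `h` on `ℝ^d`. -/
def kh (d : ℕ) (h : ℝ) (θ y : EuclideanSpace ℝ (Fin d)) : ℝ :=
  (2 * Real.pi * h ^ 2) ^ (-(d : ℝ) / 2) * Real.exp (-‖y - θ‖ ^ 2 / (2 * h ^ 2))

/-- Mixture of two `d`-dimensional standard Gaussian densities, multiplied by `c`. -/
def ptar (d : ℕ) (c : ℝ) (θ1 θ2 y : EuclideanSpace ℝ (Fin d)) : ℝ :=
  c * (0.5 * ((2 * Real.pi) ^ (-(d : ℝ) / 2) * Real.exp (-‖y - θ1‖ ^ 2 / 2)) +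
       0.5 * ((2 * Real.pi) ^ (-(d : ℝ) / 2) * Real.exp (-‖y - θ2‖ ^ 2 / 2)))

theorem kh_pos (d : ℕ) {h : ℝ} (hh : 0 < h) (θ y : EuclideanSpace ℝ (Fin d)) :
    0 < kh d h θ y := by
  unfold kh
  positivity

theorem ptar_pos (d : ℕ) {c : ℝ} (hc : 0 < c) (θ1 θ2 y : EuclideanSpace ℝ (Fin d)) :
    0 < ptar d c θ1 θ2 y := by
  unfold ptar
  positivity

theorem IsCompact.continuous_iSup_coe {X Y : Type*} [TopologicalSpace X] [TopologicalSpace Y]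
    {K : Set Y} (hK : IsCompact K) {f : X → Y → ℝ} (hf : Continuous (Function.uncurry f)) :
    Continuous fun x => ⨆ y : K, f x y := by
  simpa only [sSup_image'] using hK.continuous_sSup hf

theorem sq_norm_sub_two_mul_le_sq_norm_sub {E : Type*} [SeminormedAddCommGroup E] {r : ℝ} {θ : E}
    (hθ : ‖θ‖ ≤ r) (y : E) : ‖y‖ ^ 2 - 2 * r * ‖y‖ ≤ ‖y - θ‖ ^ 2 := by
  have h1 : |‖y‖ - ‖θ‖| ≤ ‖y - θ‖ := abs_norm_sub_norm_le y θ
  have h2 : (‖y‖ - ‖θ‖) ^ 2 ≤ ‖y - θ‖ ^ 2 := by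
    rw [← sq_abs]
    gcongr
  nlinarith [norm_nonneg y, norm_nonneg θ, mul_le_mul_of_nonneg_right hθ (norm_nonneg y)]

theorem sq_norm_sub_le_sq_norm_add {E : Type*} [SeminormedAddCommGroup E] {r : ℝ} {θ : E}
    (hθ : ‖θ‖ ≤ r) (y : E) : ‖y - θ‖ ^ 2 ≤ (‖y‖ + r) ^ 2 := by
  gcongr
  exact (norm_sub_le y θ).trans (by gcongr)

theorem kh_le {d : ℕ} {h r : ℝ} (hh : 0 < h) {θ : EuclideanSpace ℝ (Fin d)} (hθ : ‖θ‖ ≤ r)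
    (y : EuclideanSpace ℝ (Fin d)) :
    kh d h θ y ≤ (2 * Real.pi * h ^ 2) ^ (-(d : ℝ) / 2) *
      Real.exp (-(‖y‖ ^ 2 - 2 * r * ‖y‖) / (2 * h ^ 2)) := by
  unfold kh
  gcongr
  exact sq_norm_sub_two_mul_le_sq_norm_sub hθ y

theorem le_kh {d : ℕ} {h r : ℝ} (hh : 0 < h) {θ : EuclideanSpace ℝ (Fin d)} (hθ : ‖θ‖ ≤ r)
    (y : EuclideanSpace ℝ (Fin d)) :
    (2 * Real.pi * h ^ 2) ^ (-(d : ℝ) / 2) * Real.exp (-(‖y‖ + r) ^ 2 / (2 * h ^ 2)) ≤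
      kh d h θ y := by
  unfold kh
  gcongr ?_ * Real.exp (-?_ / _)
  exact sq_norm_sub_le_sq_norm_add hθ y

theorem ptar_le {d : ℕ} {c r : ℝ} (hc : 0 < c) {θ1 θ2 : EuclideanSpace ℝ (Fin d)}
    (hθ1 : ‖θ1‖ ≤ r) (hθ2 : ‖θ2‖ ≤ r) (y : EuclideanSpace ℝ (Fin d)) :
    ptar d c θ1 θ2 y ≤ c * (2 * Real.pi) ^ (-(d : ℝ) / 2) *
      Real.exp (-(‖y‖ ^ 2 - 2 * r * ‖y‖) / 2) := by
  have key : ∀ θ : EuclideanSpace ℝ (Fin d), ‖θ‖ ≤ r →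
      (2 * Real.pi) ^ (-(d : ℝ) / 2) * Real.exp (-‖y - θ‖ ^ 2 / 2) ≤
      (2 * Real.pi) ^ (-(d : ℝ) / 2) * Real.exp (-(‖y‖ ^ 2 - 2 * r * ‖y‖) / 2) := by
    intro θ hθ
    gcongr
    exact sq_norm_sub_two_mul_le_sq_norm_sub hθ y
  unfold ptar
  rw [mul_assoc]
  gcongr
  linarith [key θ1 hθ1, key θ2 hθ2]

theorem kh_div_ptar_rpow_le {d : ℕ} {h c r β : ℝ} (hh : 0 < h) (hc : 0 < c) (hβ : β ≤ 0)
    {θ θ1 θ2 : EuclideanSpace ℝ (Fin d)} (hθ : ‖θ‖ ≤ r) (hθ1 : ‖θ1‖ ≤ r) (hθ2 : ‖θ2‖ ≤ r)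
    (y : EuclideanSpace ℝ (Fin d)) :
    (kh d h θ y / ptar d c θ1 θ2 y) ^ β ≤
      ((2 * Real.pi * h ^ 2) ^ (-(d : ℝ) / 2) / (c * (2 * Real.pi) ^ (-(d : ℝ) / 2))) ^ β *
      Real.exp ((-(‖y‖ + r) ^ 2 / (2 * h ^ 2) + (‖y‖ ^ 2 - 2 * r * ‖y‖) / 2) * β) := by
  rw [Real.exp_mul, ← Real.mul_rpow (by positivity) (by positivity)]
  refine Real.rpow_le_rpow_of_nonpos (by positivity) ?_ hβ
  calc _ = (2 * Real.pi * h ^ 2) ^ (-(d : ℝ) / 2) * Real.exp (-(‖y‖ + r) ^ 2 / (2 * h ^ 2)) /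
        (c * (2 * Real.pi) ^ (-(d : ℝ) / 2) * Real.exp (-(‖y‖ ^ 2 - 2 * r * ‖y‖) / 2)) := by
        rw [Real.exp_add, neg_div 2 (‖y‖ ^ 2 - 2 * r * ‖y‖), Real.exp_neg]
        field_simp
    _ ≤ _ := div_le_div₀ (kh_pos d hh θ y).le (le_kh hh hθ y) (ptar_pos d hc θ1 θ2 y)
        (ptar_le hc hθ1 hθ2 y)

theorem integrable_exp_neg_mul_sq_norm {V : Type*} [NormedAddCommGroup V]
    [InnerProductSpace ℝ V] [FiniteDimensional ℝ V] [MeasurableSpace V] [BorelSpace V]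
    {a : ℝ} (ha : 0 < a) : Integrable fun v : V => Real.exp (-a * ‖v‖ ^ 2) := by
  have := (GaussianFourier.integrable_cexp_neg_mul_sq_norm_add (V := V) (b := (a : ℂ))
    (by simpa using ha) 0 0).norm
  refine this.congr (Filter.Eventually.of_forall fun v => ?_)
  simp [Complex.norm_exp, ← Complex.ofReal_pow]

theorem integrable_exp_neg_mul_sq_norm_add_mul_norm {V : Type*} [NormedAddCommGroup V]
    [InnerProductSpace ℝ V] [FiniteDimensional ℝ V] [MeasurableSpace V] [BorelSpace V]
    {a : ℝ} (ha : 0 < a) (b : ℝ) :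
    Integrable fun v : V => Real.exp (-a * ‖v‖ ^ 2 + b * ‖v‖) := by
  refine ((integrable_exp_neg_mul_sq_norm (V := V) (half_pos ha)).const_mul
    (Real.exp (b ^ 2 / (2 * a)))).mono' (by fun_prop) (Filter.Eventually.of_forall fun v => ?_)
  rw [Real.norm_of_nonneg (Real.exp_nonneg _), ← Real.exp_add, Real.exp_le_exp]
  have : b ^ 2 / (2 * a) + -(a / 2) * ‖v‖ ^ 2 - (-a * ‖v‖ ^ 2 + b * ‖v‖) =
      (a * ‖v‖ - b) ^ 2 / (2 * a) := by
    field_simp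
    ring
  have : 0 ≤ (a * ‖v‖ - b) ^ 2 / (2 * a) := by positivity
  linarith

/-- The first integrability condition of A3 holds in the Gaussian example of the paper. -/
theorem gaussian_example_A3_first
    (d : ℕ) (hd : 0 < d) (r h c α : ℝ) (hr : 0 < r) (hh : 0 < h) (hc : 0 < c)
    (hα0 : 0 ≤ α) (hα1 : α < 1)
    (θ1 θ2 : EuclideanSpace ℝ (Fin d))
    (hθ1 : θ1 ∈ Metric.closedBall (0 : EuclideanSpace ℝ (Fin d)) r)
    (hθ2 : θ2 ∈ Metric.closedBall (0 : EuclideanSpace ℝ (Fin d)) r) :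
    Integrable (fun y : EuclideanSpace ℝ (Fin d) =>
      (⨆ θ : Metric.closedBall (0 : EuclideanSpace ℝ (Fin d)) r, kh d h θ.1 y) *
      (⨆ θ' : Metric.closedBall (0 : EuclideanSpace ℝ (Fin d)) r,
        (kh d h θ'.1 y / ptar d c θ1 θ2 y) ^ (α - 1))) volume := by
  have hK : IsCompact (Metric.closedBall (0 : EuclideanSpace ℝ (Fin d)) r) :=
    isCompact_closedBall 0 r
  have : Nonempty (Metric.closedBall (0 : EuclideanSpace ℝ (Fin d)) r) := ⟨⟨θ1, hθ1⟩⟩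
  have hkh : Continuous fun p : EuclideanSpace ℝ (Fin d) × EuclideanSpace ℝ (Fin d) =>
      kh d h p.2 p.1 := by
    unfold kh
    fun_prop
  have hptar : Continuous fun p : EuclideanSpace ℝ (Fin d) × EuclideanSpace ℝ (Fin d) =>
      ptar d c θ1 θ2 p.1 := by
    unfold ptar
    fun_prop
  have hcont1 := hK.continuous_iSup_coe (f := fun y θ => kh d h θ y) hkh
  have hcont2 := hK.continuous_iSup_coe
    (f := fun y θ => (kh d h θ y / ptar d c θ1 θ2 y) ^ (α - 1))
    ((hkh.div₀ hptar fun p => (ptar_pos d hc θ1 θ2 p.1).ne').rpow_const fun p =>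
      Or.inl (div_pos (kh_pos d hh p.2 p.1) (ptar_pos d hc θ1 θ2 p.1)).ne')
  rw [mem_closedBall_zero_iff] at hθ1 hθ2
  have ha : 0 < α / (2 * h ^ 2) + (1 - α) / 2 :=
    add_pos_of_nonneg_of_pos (by positivity) (by linarith)
  set A := (2 * Real.pi * h ^ 2) ^ (-(d : ℝ) / 2) with hA
  set B := (A / (c * (2 * Real.pi) ^ (-(d : ℝ) / 2))) ^ (α - 1) with hB
  refine ((integrable_exp_neg_mul_sq_norm_add_mul_norm ha
    (r / h ^ 2 + (1 - α) * r + (1 - α) * r / h ^ 2)).const_mul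
    (A * B * Real.exp ((1 - α) * r ^ 2 / (2 * h ^ 2)))).mono'
    (hcont1.mul hcont2).aestronglyMeasurable (Filter.Eventually.of_forall fun y => ?_)
  have hnonneg1 : 0 ≤ ⨆ θ : Metric.closedBall (0 : EuclideanSpace ℝ (Fin d)) r, kh d h θ.1 y :=
    Real.iSup_nonneg fun θ => (kh_pos d hh _ _).le
  have hnonneg2 : 0 ≤ ⨆ θ' : Metric.closedBall (0 : EuclideanSpace ℝ (Fin d)) r,
      (kh d h θ'.1 y / ptar d c θ1 θ2 y) ^ (α - 1) :=
    Real.iSup_nonneg fun θ =>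
      Real.rpow_nonneg (div_pos (kh_pos d hh _ _) (ptar_pos d hc _ _ _)).le _
  rw [Real.norm_of_nonneg (mul_nonneg hnonneg1 hnonneg2)]
  refine (mul_le_mul (ciSup_le fun θ => kh_le hh (mem_closedBall_zero_iff.1 θ.2) y)
    (ciSup_le fun θ => kh_div_ptar_rpow_le hh hc (by linarith)
      (mem_closedBall_zero_iff.1 θ.2) hθ1 hθ2 y) hnonneg2 (by positivity)).trans_eq ?_
  rw [← hA, ← hB, mul_mul_mul_comm, mul_assoc (A * B), ← Real.exp_add, ← Real.exp_add]
  congr 2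
  field_simp
  ring
end
end

section
/- Let d ∈ ℕ*, r > 0, h > 0, c > 0. Let k_h(θ,y) = (2πh²)^{−d/2} exp(−‖y−θ‖²/(2h²)) and let p(y) = c · [0.5 (2π)^{−d/2} exp(−‖y−θ_1*‖²/2) + 0.5 (2π)^{−d/2} exp(−‖y−θ_2*‖²/2)] with θ_1*, θ_2* in the closed ball B̄(0,r) ⊂ ℝ^d. Then for all y ∈ ℝ^d and all θ ∈ B̄(0,r): |log(k_h(θ,y)/p(y))| ≤ ((‖y‖+r)²/2)·(1/h² + 1) + d|log h| + |log c|. -/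
open MeasureTheory Real

noncomputable section

/-- Squared distance to a point of the ball of radius `r` is at most `(‖y‖ + r) ^ 2`. -/
theorem norm_sub_sq_le_of_mem_closedBall {E : Type*} [SeminormedAddCommGroup E] {r : ℝ} {y θ : E}
    (hθ : θ ∈ Metric.closedBall (0 : E) r) : ‖y - θ‖ ^ 2 ≤ (‖y‖ + r) ^ 2 := by
  have h1 : ‖θ‖ ≤ r := by simpa using hθ
  have h2 : ‖y - θ‖ ≤ ‖y‖ + r := (norm_sub_le y θ).trans (by gcongr)
  gcongr

theorem log_kh (d : ℕ) {h : ℝ} (hh : 0 < h) (θ y : EuclideanSpace ℝ (Fin d)) :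
    Real.log (kh d h θ y) =
      -(d : ℝ) / 2 * Real.log (2 * Real.pi) - d * Real.log h - ‖y - θ‖ ^ 2 / (2 * h ^ 2) := by
  have hpi : 0 < 2 * Real.pi := by positivity
  have hpos : 0 < 2 * Real.pi * h ^ 2 := by positivity
  rw [kh, Real.log_mul (Real.rpow_pos_of_pos hpos _).ne' (Real.exp_pos _).ne', Real.log_exp,
    Real.log_rpow hpos, Real.log_mul hpi.ne' (by positivity), Real.log_pow]
  push_cast
  ring

theorem log_ptar (d : ℕ) {c : ℝ} (hc : 0 < c) (θ1 θ2 y : EuclideanSpace ℝ (Fin d)) :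
    Real.log (ptar d c θ1 θ2 y) =
      Real.log c + -(d : ℝ) / 2 * Real.log (2 * Real.pi) +
        Real.log ((Real.exp (-‖y - θ1‖ ^ 2 / 2) + Real.exp (-‖y - θ2‖ ^ 2 / 2)) / 2) := by
  have hpi : 0 < 2 * Real.pi := by positivity
  have hfac : ptar d c θ1 θ2 y = c * (2 * Real.pi) ^ (-(d : ℝ) / 2) *
      ((Real.exp (-‖y - θ1‖ ^ 2 / 2) + Real.exp (-‖y - θ2‖ ^ 2 / 2)) / 2) := by
    rw [ptar]
    ring
  have hpow : 0 < (2 * Real.pi) ^ (-(d : ℝ) / 2) := Real.rpow_pos_of_pos hpi _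
  rw [hfac, Real.log_mul (by positivity) (by positivity), Real.log_mul hc.ne' hpow.ne',
    Real.log_rpow hpi]

/-- The logarithm of the average of two exponentials lies between any common bounds of the
exponents. -/
theorem log_avg_exp_mem_Icc {a b l u : ℝ} (ha : a ∈ Set.Icc l u) (hb : b ∈ Set.Icc l u) :
    Real.log ((Real.exp a + Real.exp b) / 2) ∈ Set.Icc l u := by
  have hpos : 0 < (Real.exp a + Real.exp b) / 2 := by positivity
  constructor
  · rw [Real.le_log_iff_exp_le hpos]
    linarith [Real.exp_le_exp.2 ha.1, Real.exp_le_exp.2 hb.1]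
  · rw [Real.log_le_iff_le_exp hpos]
    linarith [Real.exp_le_exp.2 ha.2, Real.exp_le_exp.2 hb.2]

/-- Bound on `|log(k_h(θ,y)/p(y))|` in the Gaussian example (equation (15) of the paper). -/
theorem gaussian_log_ratio_bound
    (d : ℕ) (hd : 0 < d) (r h c : ℝ) (hr : 0 < r) (hh : 0 < h) (hc : 0 < c)
    (θ1 θ2 : EuclideanSpace ℝ (Fin d))
    (hθ1 : θ1 ∈ Metric.closedBall (0 : EuclideanSpace ℝ (Fin d)) r)
    (hθ2 : θ2 ∈ Metric.closedBall (0 : EuclideanSpace ℝ (Fin d)) r)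
    (y : EuclideanSpace ℝ (Fin d)) (θ : EuclideanSpace ℝ (Fin d))
    (hθ : θ ∈ Metric.closedBall (0 : EuclideanSpace ℝ (Fin d)) r) :
    |Real.log (kh d h θ y / ptar d c θ1 θ2 y)| ≤
      (‖y‖ + r) ^ 2 / 2 * (1 / h ^ 2 + 1) + d * |Real.log h| + |Real.log c| := by
  have hpi : 0 < 2 * Real.pi := by positivity
  have hk : kh d h θ y ≠ 0 :=
    (mul_pos (Real.rpow_pos_of_pos (by positivity) _) (Real.exp_pos _)).ne'
  have hp : ptar d c θ1 θ2 y ≠ 0 := by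
    have hpow : 0 < (2 * Real.pi) ^ (-(d : ℝ) / 2) := Real.rpow_pos_of_pos hpi _
    rw [ptar]
    positivity
  have hA : ‖y - θ‖ ^ 2 / (2 * h ^ 2) ≤ (‖y‖ + r) ^ 2 / (2 * h ^ 2) := by
    gcongr ?_ / _
    exact norm_sub_sq_le_of_mem_closedBall hθ
  have hA0 : 0 ≤ ‖y - θ‖ ^ 2 / (2 * h ^ 2) := by positivity
  have hexp : ∀ t ∈ Metric.closedBall (0 : EuclideanSpace ℝ (Fin d)) r,
      -‖y - t‖ ^ 2 / 2 ∈ Set.Icc (-((‖y‖ + r) ^ 2 / 2)) 0 := fun t ht => by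
    have := norm_sub_sq_le_of_mem_closedBall (y := y) ht
    constructor <;> linarith [sq_nonneg ‖y - t‖]
  obtain ⟨hM1, hM2⟩ := log_avg_exp_mem_Icc (hexp θ1 hθ1) (hexp θ2 hθ2)
  have hS : (‖y‖ + r) ^ 2 / 2 * (1 / h ^ 2 + 1) =
      (‖y‖ + r) ^ 2 / (2 * h ^ 2) + (‖y‖ + r) ^ 2 / 2 := by
    field_simp
  have hS0 : 0 ≤ (‖y‖ + r) ^ 2 / 2 := by positivity
  have hlogh := abs_le.1
    (by rw [abs_mul, Nat.abs_cast] : |(d : ℝ) * Real.log h| ≤ d * |Real.log h|)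
  have hlogc := abs_le.1 (le_refl |Real.log c|)
  rw [Real.log_div hk hp, log_kh d hh, log_ptar d hc, hS, abs_le]
  constructor <;> linarith [hlogh.1, hlogh.2, hlogc.1, hlogc.2]
end
end

section
/- Assume A1 with p replaced by a measurable function φ : Y → (0,∞), set Z = ∫_Y φ dν and assume 0 < Z < ∞. Let α ∈ ℝ \ {0,1} and let μ be a probability measure on T such that ∫_Y μk(y) ν(dy) = 1 and the integrals below are finite. Then ∫_Y f_α( μk(y) / (φ(y)/Z) ) (φ(y)/Z) ν(dy) = Z^{α−1} ∫_Y f_α( μk(y)/φ(y) ) φ(y) ν(dy) + (α Z^{α−1} + (1−α) Z^α − 1)/(α(α−1)). -/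
open MeasureTheory Real Filter Topology
open scoped Classical

noncomputable section

variable {Y T : Type*} [MeasurableSpace Y] [MeasurableSpace T]

/-- The `α`-divergence generator `f_α`. -/
def fdiv (α u : ℝ) : ℝ :=
  if α = 0 then u - 1 - Real.log u
  else if α = 1 then 1 - u + u * Real.log u
  else (u ^ α - 1 - α * (u - 1)) / (α * (α - 1))

/-- The derivative `f_α'` of the `α`-divergence generator. -/
def fdiv' (α u : ℝ) : ℝ :=
  if α = 0 then 1 - 1 / u
  else if α = 1 then Real.log u
  else (u ^ (α - 1) - 1) / (α - 1)

/-- `μk(y) = ∫_T k(θ, y) μ(dθ)`. -/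
def muK (k : T → Y → ℝ) (μ : Measure T) (y : Y) : ℝ := ∫ θ, k θ y ∂μ

/-- The objective `Ψ_α(μ) = ∫_Y f_α(μk(y)/p(y)) p(y) ν(dy)`. -/
def Psi (k : T → Y → ℝ) (p : Y → ℝ) (ν : Measure Y) (α : ℝ) (μ : Measure T) : ℝ :=
  ∫ y, fdiv α (muK k μ y / p y) * p y ∂ν

/-- The gradient `b_{μ,α}(θ) = ∫_Y k(θ,y) f_α'(μk(y)/p(y)) ν(dy)`. -/
def bfun (k : T → Y → ℝ) (p : Y → ℝ) (ν : Measure Y) (α : ℝ) (μ : Measure T) (θ : T) : ℝ :=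
  ∫ y, k θ y * fdiv' α (muK k μ y / p y) ∂ν

/-- `Γ_α(v) = ((α-1)v + 1)^{η/(1-α)}`. -/
def Gam (α η v : ℝ) : ℝ := ((α - 1) * v + 1) ^ (η / (1 - α))

/-- Rescaling the reference density by `Z` changes the `α`-divergence integrand by a factor and
terms linear in the two densities. -/
theorem fdiv_div_scale {α Z m p : ℝ} (hα0 : α ≠ 0) (hα1 : α ≠ 1) (hZ : 0 < Z) (hm : 0 ≤ m)
    (hp : 0 < p) :
    fdiv α (m / (p / Z)) * (p / Z) =
      Z ^ (α - 1) * (fdiv α (m / p) * p) +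
        ((1 - α) * (Z ^ (α - 1) - 1 / Z) / (α * (α - 1)) * p +
          α * (Z ^ (α - 1) - 1) / (α * (α - 1)) * m) := by
  have hα1' : α - 1 ≠ 0 := sub_ne_zero.mpr hα1
  have hscale : m / (p / Z) = Z * (m / p) := by field_simp
  rw [hscale, fdiv, fdiv, if_neg hα0, if_neg hα1, if_neg hα0, if_neg hα1,
    mul_rpow hZ.le (div_nonneg hm hp.le), rpow_sub_one hZ.ne']
  generalize (m / p) ^ α = A
  generalize Z ^ α = B
  field_simp
  ring

/-- Normalisation identity for the `α`-divergence objective, `α ∉ {0,1}`. -/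
theorem normalisation_identity_alpha
    {Y T : Type*} [MeasurableSpace Y] [MeasurableSpace T]
    (ν : Measure Y) [SigmaFinite ν]
    (k : T → Y → ℝ) (φ : Y → ℝ)
    (hkmeas : Measurable (Function.uncurry k)) (hφmeas : Measurable φ)
    (hkpos : ∀ θ y, 0 < k θ y) (hφpos : ∀ y, 0 < φ y)
    (hφint : Integrable φ ν)
    (Z : ℝ) (hZ : Z = ∫ y, φ y ∂ν) (hZpos : 0 < Z)
    (α : ℝ) (hα0 : α ≠ 0) (hα1 : α ≠ 1)
    (μ : Measure T) [IsProbabilityMeasure μ]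
    (hnorm : ∫ y, muK k μ y ∂ν = 1)
    (hint1 : Integrable (fun y => fdiv α (muK k μ y / (φ y / Z)) * (φ y / Z)) ν)
    (hint2 : Integrable (fun y => fdiv α (muK k μ y / φ y) * φ y) ν) :
    ∫ y, fdiv α (muK k μ y / (φ y / Z)) * (φ y / Z) ∂ν =
      Z ^ (α - 1) * (∫ y, fdiv α (muK k μ y / φ y) * φ y ∂ν) +
        (α * Z ^ (α - 1) + (1 - α) * Z ^ α - 1) / (α * (α - 1)) := by
  have hα1' : α - 1 ≠ 0 := sub_ne_zero.mpr hα1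
  have hm : Integrable (fun y => muK k μ y) ν := by
    by_contra h
    rw [integral_undef h] at hnorm
    exact zero_ne_one hnorm
  have hm_nonneg (y : Y) : 0 ≤ muK k μ y := integral_nonneg fun θ => (hkpos θ y).le
  have hpoint (y : Y) := fdiv_div_scale hα0 hα1 hZpos (hm_nonneg y) (hφpos y)
  simp_rw [hpoint]
  rw [integral_add (hint2.const_mul _) ((hφint.const_mul _).fun_add (hm.const_mul _)),
    integral_add (hφint.const_mul _) (hm.const_mul _), integral_const_mul, integral_const_mul,
    integral_const_mul, hnorm, ← hZ, rpow_sub_one hZpos.ne']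
  generalize Z ^ α = B
  field_simp
  ring
end
end
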